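/- Let h : ℝ → ℝ be four times continuously differentiable with h'(0) = 0 and h''(0) < 0. Then there exist δ > 0 and constants C₁ > 0, C₂ > 0 such that for all t with |t| ≤ δ: | e^{h(t) − h(0)} − e^{h''(0)t²/2} − (h'''(0)/6) t³ e^{h''(0)t²/2} | ≤ (C₁ t⁴ + C₂ t⁶) e^{h''(0)t²/4}. -/

import Mathlib

open Filter Topology in
/-- Fourth-order Taylor bound at the origin for a `C⁴` function. -/
theorem exists_eventually_abs_taylor_cubic_le (h : ℝ → ℝ) (hsmooth : ContDiff ℝ 4 h) :
    ∃ M > 0, ∀ᶠ t in 𝓝 0,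
      |h t - (h 0 + deriv h 0 * t + iteratedDeriv 2 h 0 * t ^ 2 / 2
        + iteratedDeriv 3 h 0 / 6 * t ^ 3)| ≤ M * t ^ 4 := by
  refine ⟨|iteratedDeriv 4 h 0| / 24 + 1, by positivity, ?_⟩
  have hsmooth' : ContDiff ℝ (4 : ℕ) h := by exact_mod_cast hsmooth
  filter_upwards [(taylor_isLittleO_univ hsmooth' (x₀ := 0)).bound one_pos] with t ht
  simp only [taylor_within_apply, Finset.sum_range_succ, Finset.sum_range_zero,
    iteratedDerivWithin_univ, sub_zero, Real.norm_eq_abs, smul_eq_mul, one_mul, abs_pow,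
    iteratedDeriv_zero, iteratedDeriv_one, Nat.factorial] at ht
  rw [Even.pow_abs (by decide)] at ht
  have hquartic : |iteratedDeriv 4 h 0 * t ^ 4 / 24| = |iteratedDeriv 4 h 0| / 24 * t ^ 4 := by
    rw [abs_div, abs_mul, abs_of_nonneg (by positivity : (0 : ℝ) ≤ t ^ 4),
      abs_of_pos (by norm_num : (0 : ℝ) < 24)]
    ring
  calc
    _ = |(h t - _) + iteratedDeriv 4 h 0 * t ^ 4 / 24| := by
      congr 1
      norm_num
      ring
    _ ≤ _ := abs_add_le _ _
    _ ≤ t ^ 4 + |iteratedDeriv 4 h 0| / 24 * t ^ 4 := add_le_add ht hquartic.le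
    _ = _ := by ring

/-- First-order expansion of `exp` at a point `r` approximated by `p` up to an error `m`. -/
theorem Real.abs_exp_sub_one_sub_le_of_abs_sub_le {r p m : ℝ} (hr : |r| ≤ 1)
    (hrp : |r - p| ≤ m) : |Real.exp r - 1 - p| ≤ m + r ^ 2 := by
  have hexp := Real.abs_exp_sub_one_sub_id_le hr
  rw [abs_le] at *
  constructor <;> linarith


/-- **Exponential expansion.** If `h : ℝ → ℝ` is `C⁴` with `h'(0) = 0` and `h''(0) < 0`,
then there exist `δ > 0` and constants `C₁, C₂ > 0` such that for all `|t| ≤ δ`,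
`|e^{h(t)-h(0)} − e^{h''(0)t²/2} − (h'''(0)/6) t³ e^{h''(0)t²/2}| ≤ (C₁t⁴ + C₂t⁶) e^{h''(0)t²/4}`. -/
theorem exponential_expansion
    (h : ℝ → ℝ) (hsmooth : ContDiff ℝ 4 h)
    (h'0 : deriv h 0 = 0) (h''0 : iteratedDeriv 2 h 0 < 0) :
    ∃ δ > 0, ∃ C₁ > 0, ∃ C₂ > 0, ∀ t : ℝ, |t| ≤ δ →
      |Real.exp (h t - h 0) - Real.exp (iteratedDeriv 2 h 0 * t ^ 2 / 2)
        - iteratedDeriv 3 h 0 / 6 * t ^ 3 * Real.exp (iteratedDeriv 2 h 0 * t ^ 2 / 2)|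
      ≤ (C₁ * t ^ 4 + C₂ * t ^ 6) * Real.exp (iteratedDeriv 2 h 0 * t ^ 2 / 4) := by
  obtain ⟨M, hM, hbound⟩ := exists_eventually_abs_taylor_cubic_le h hsmooth
  obtain ⟨ε, hε, hball⟩ := Metric.eventually_nhds_iff.mp hbound
  set a := iteratedDeriv 2 h 0
  set b := iteratedDeriv 3 h 0
  have hK : 0 < |b| / 6 + M := by positivity
  set K := |b| / 6 + M with hKdef
  refine ⟨min (ε / 2) (min 1 (1 / K)), by positivity, M, hM, K ^ 2, by positivity,
    fun t ht => ?_⟩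
  obtain ⟨htε, ht1, htK⟩ : |t| ≤ ε / 2 ∧ |t| ≤ 1 ∧ |t| ≤ 1 / K := by simpa using ht
  have htaylor := hball (y := t) (by rw [Real.dist_eq, sub_zero]; linarith)
  rw [h'0] at htaylor
  set r := h t - h 0 - a * t ^ 2 / 2 with hr
  have hrem : |r - b / 6 * t ^ 3| ≤ M * t ^ 4 := by
    convert htaylor using 2
    ring
  have hr_le : |r| ≤ K * |t| ^ 3 := by
    have hcubic : |b / 6 * t ^ 3| = |b| / 6 * |t| ^ 3 := by
      rw [abs_mul, abs_div, abs_pow, abs_of_pos (by norm_num : (0 : ℝ) < 6)]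
    have hquartic : t ^ 4 ≤ |t| ^ 3 := by
      rw [← Even.pow_abs (by decide : Even 4) t]
      exact pow_le_pow_of_le_one (abs_nonneg t) ht1 (by norm_num)
    have htri := abs_add_le (r - b / 6 * t ^ 3) (b / 6 * t ^ 3)
    rw [sub_add_cancel, hcubic] at htri
    have := mul_le_mul_of_nonneg_left hquartic hM.le
    rw [hKdef]
    linarith
  have hr_one : |r| ≤ 1 := by
    have hcube : |t| ^ 3 ≤ |t| := pow_le_of_le_one (abs_nonneg t) ht1 (by norm_num)
    calc |r| ≤ K * |t| ^ 3 := hr_le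
      _ ≤ K * (1 / K) := by gcongr; exact hcube.trans htK
      _ = 1 := by field_simp
  have hr_sq : r ^ 2 ≤ K ^ 2 * t ^ 6 := by
    calc r ^ 2 = |r| ^ 2 := (sq_abs r).symm
      _ ≤ (K * |t| ^ 3) ^ 2 := by gcongr
      _ = K ^ 2 * t ^ 6 := by rw [mul_pow, ← pow_mul, Even.pow_abs (by decide)]
  have hsplit : Real.exp (h t - h 0) = Real.exp (a * t ^ 2 / 2) * Real.exp r := by
    rw [← Real.exp_add, hr]
    ring_nf
  have hgauss : Real.exp (a * t ^ 2 / 2) ≤ Real.exp (a * t ^ 2 / 4) := by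
    apply Real.exp_le_exp.mpr
    linarith [mul_nonpos_of_nonpos_of_nonneg h''0.le (sq_nonneg t)]
  calc
    _ = |Real.exp r - 1 - b / 6 * t ^ 3| * Real.exp (a * t ^ 2 / 2) := by
      rw [hsplit, ← abs_of_pos (Real.exp_pos (a * t ^ 2 / 2)), ← abs_mul,
        abs_of_pos (Real.exp_pos (a * t ^ 2 / 2))]
      ring_nf
    _ ≤ (M * t ^ 4 + K ^ 2 * t ^ 6) * Real.exp (a * t ^ 2 / 4) := by
      have := Real.abs_exp_sub_one_sub_le_of_abs_sub_le hr_one hrem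
      gcongr
      linarith
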